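/- If D ∈ pPLL∞ is finitely expandable, then there exists a finite set V of pairwise incomparable nodes of D such that the pruning D|V (obtained by replacing each sub-coderivation of D rooted at a node of V by hyp) is an open derivation (a finite open coderivation), and every node in V is the root of a non-wellfounded box in D. -/

import Mathlib

namespace NWPLL

/-! ## Formulas and sequents -/

inductive Formula : Type where
  | var : ℕ → Formula
  | covar : ℕ → Formula
  | tens : Formula → Formula → Formula
  | parr : Formula → Formula → Formula
  | bang : Formula → Formula
  | quest : Formula → Formula
  | one : Formula
  | bot : Formula
deriving DecidableEq

/-- Linear negation, defined by De Morgan duality. -/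
def Formula.neg : Formula → Formula
  | .var n => .covar n
  | .covar n => .var n
  | .tens A B => .parr A.neg B.neg
  | .parr A B => .tens A.neg B.neg
  | .bang A => .quest A.neg
  | .quest A => .bang A.neg
  | .one => .bot
  | .bot => .one

/-- A sequent is a finite list of formula occurrences. -/
abbrev Sequent := List Formula

/-! ## Rules -/

inductive RuleName : Type where
  | ax | cut | tens | parr | one | bot | qw | qb | cp | fp | hyp | dig
deriving DecidableEq

/-- Canonical instances of the rules (principal formulas at the head,
conclusion of a rule together with the list of its premises, in order). -/
inductive Canon : RuleName → Sequent → List Sequent → Prop where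
  | ax (A : Formula) : Canon .ax [A, A.neg] []
  | cut (A : Formula) (Γ Δ : Sequent) : Canon .cut (Γ ++ Δ) [A :: Γ, A.neg :: Δ]
  | tens (A B : Formula) (Γ Δ : Sequent) :
      Canon .tens (A.tens B :: (Γ ++ Δ)) [A :: Γ, B :: Δ]
  | parr (A B : Formula) (Γ : Sequent) : Canon .parr (A.parr B :: Γ) [A :: B :: Γ]
  | one : Canon .one [.one] []
  | bot (Γ : Sequent) : Canon .bot (.bot :: Γ) [Γ]
  | qw (A : Formula) (Γ : Sequent) : Canon .qw (A.quest :: Γ) [Γ]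
  | qb (A : Formula) (Γ : Sequent) : Canon .qb (A.quest :: Γ) [A :: A.quest :: Γ]
  | cp (A : Formula) (Γ : Sequent) :
      Canon .cp (A.bang :: Γ.map .quest) [A :: Γ, A.bang :: Γ.map .quest]
  | fp (A : Formula) (Γ : Sequent) : Canon .fp (A.bang :: Γ.map .quest) [A :: Γ]
  | hyp (Γ : Sequent) : Canon .hyp Γ []
  | dig (A : Formula) (Γ : Sequent) : Canon .dig (A.quest :: Γ) [A.quest.quest :: Γ]

/-- A rule instance: a canonical instance up to permutation of each sequent
(sequents are lists of occurrences, managed up to exchange). -/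
def RuleOk (r : RuleName) (C : Sequent) (ps : List Sequent) : Prop :=
  ∃ C₀ ps₀, Canon r C₀ ps₀ ∧ C.Perm C₀ ∧ List.Forall₂ List.Perm ps ps₀

/-! ## Coderivations -/

/-- Nodes of a binary tree: `false` = first (left) child, `true` = second (right) child. -/
abbrev Node := List Bool

/-- A (possibly non-wellfounded) coderivation skeleton: a labelling of an
ordered-prefix-closed binary tree by pairs (rule name, sequent). -/
structure Coderivation : Type where
  label : Node → Option (RuleName × Sequent)
  root_isSome : (label []).isSome
  prefix_closed : ∀ v b, (label (v ++ [b])).isSome → (label v).isSome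
  ordered : ∀ v, (label (v ++ [true])).isSome → (label (v ++ [false])).isSome

namespace Coderivation

def mem (D : Coderivation) (v : Node) : Prop := (D.label v).isSome

def ruleAt (D : Coderivation) (v : Node) : Option RuleName := (D.label v).map Prod.fst

def seqAt (D : Coderivation) (v : Node) : Option Sequent := (D.label v).map Prod.snd

def conclusion (D : Coderivation) : Sequent := ((D.label []).map Prod.snd).getD []

/-- The list of premises (sequents of the children) of the rule at node `v`. -/
def premsAt (D : Coderivation) (v : Node) : List Sequent :=
  (D.seqAt (v ++ [false])).toList ++ (D.seqAt (v ++ [true])).toList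

/-- `D` is a coderivation over the set of rules `S`: each node is a valid
instance of a rule of `S`. -/
def IsOver (D : Coderivation) (S : Set RuleName) : Prop :=
  ∀ v r Γ, D.label v = some (r, Γ) → r ∈ S ∧ RuleOk r Γ (D.premsAt v)

def IsFinite (D : Coderivation) : Prop := {v : Node | D.mem v}.Finite

end Coderivation

/-! ## Systems -/

def pllRules : Set RuleName := {.ax, .cut, .tens, .parr, .one, .bot, .qw, .qb, .fp}
def pllInfRules : Set RuleName := {.ax, .cut, .tens, .parr, .one, .bot, .qw, .qb, .cp}
def oPllInfRules : Set RuleName := insert .hyp pllInfRules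
def mellInfRules : Set RuleName := insert .dig pllInfRules

/-- Coderivations of `PLL∞`. -/
def PLLinf (D : Coderivation) : Prop := D.IsOver pllInfRules
/-- Open coderivations (`oPLL∞`). -/
def OPLLinf (D : Coderivation) : Prop := D.IsOver oPllInfRules
/-- Coderivations of `MELL∞` (with digging). -/
def MELLinf (D : Coderivation) : Prop := D.IsOver mellInfRules
/-- Finite derivations of the sequent calculus `PLL` (with functorial promotion). -/
def IsPLLDer (D : Coderivation) : Prop := D.IsOver pllRules ∧ D.IsFinite

/-! ## Branches and global conditions -/

/-- The node at depth `n` along the infinite branch determined by the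
direction function `β`. -/
def brNode (β : ℕ → Bool) (n : ℕ) : Node := (List.range n).map β

def InfBranch (D : Coderivation) (β : ℕ → Bool) : Prop := ∀ n, D.mem (brNode β n)

/-- Weak progressing: every infinite branch goes through the right premise of
a `c!p` rule infinitely often. -/
def WeaklyProg (D : Coderivation) : Prop :=
  ∀ β, InfBranch D β →
    ∀ N, ∃ n, N ≤ n ∧ β n = true ∧ D.ruleAt (brNode β n) = some .cp

/-- Position of the parent (in canonical instances): `childParent r k b p` is
the position in the conclusion of which the formula at position `p` of premise
`b` is the parent; `k` is the length of the first premise. -/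
def childParent : RuleName → ℕ → Bool → ℕ → Option ℕ
  | .cut, _, false, p => if p = 0 then none else some (p - 1)
  | .cut, k, true, p => if p = 0 then none else some (k - 1 + (p - 1))
  | .tens, _, false, p => if p = 0 then some 0 else some p
  | .tens, k, true, p => if p = 0 then some 0 else some (k + (p - 1))
  | .parr, _, false, p => if p ≤ 1 then some 0 else some (p - 1)
  | .bot, _, false, p => some (p + 1)
  | .qw, _, false, p => some (p + 1)
  | .qb, _, false, p => if p = 0 then none else some (p - 1)
  | .cp, _, false, _ => none
  | .cp, _, true, p => some p
  | .fp, _, false, p => some p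
  | .dig, _, false, p => some p
  | _, _, _, _ => none

/-- A position-preserving alignment between a sequent and (a permutation of
it given by) a canonical sequent. -/
def PosAlign (l l' : List Formula) (f : ℕ → ℕ) : Prop :=
  l.length = l'.length ∧
  (∀ i, i < l.length → f i < l'.length ∧ l'[f i]? = l[i]?) ∧
  (∀ i j, i < l.length → j < l.length → f i = f j → i = j)

def bIdx : Bool → ℕ
  | false => 0
  | true => 1

/-- The formula occurrence at position `p` of the premise `b` of the rule at
node `v` is the parent of the occurrence at position `q` of its conclusion. -/
def IsParent (D : Coderivation) (v : Node) (b : Bool) (p q : ℕ) : Prop :=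
  ∃ r C P C₀ P₀ ps₀, ∃ f g : ℕ → ℕ,
    D.label v = some (r, C) ∧ D.seqAt (v ++ [b]) = some P ∧
    Canon r C₀ ps₀ ∧ PosAlign C C₀ f ∧ ps₀[bIdx b]? = some P₀ ∧ PosAlign P P₀ g ∧
    childParent r (ps₀.headD []).length b (g p) = some (f q)

/-- The occurrence at position `q` of the conclusion of the rule at `v` is the
principal `!`-formula of a `c!p` rule. -/
def PrincipalCp (D : Coderivation) (v : Node) (q : ℕ) : Prop :=
  ∃ C C₀ ps₀ f, D.label v = some (.cp, C) ∧ Canon .cp C₀ ps₀ ∧ PosAlign C C₀ f ∧ f q = 0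

def Coderivation.formulaAt (D : Coderivation) (v : Node) (q : ℕ) : Option Formula :=
  (D.seqAt v).bind fun Γ => Γ[q]?

/-- The infinite branch `β` carries a progressing `!`-thread: from some point
on, a sequence of parent-linked `!`-formula occurrences which is infinitely
often principal for a `c!p` rule. -/
def ProgThread (D : Coderivation) (β : ℕ → Bool) : Prop :=
  ∃ k, ∃ t : ℕ → ℕ,
    (∀ i, k ≤ i → ∃ A, D.formulaAt (brNode β i) (t i) = some (Formula.bang A)) ∧
    (∀ i, k ≤ i → IsParent D (brNode β i) (β i) (t (i + 1)) (t i)) ∧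
    (∀ N, ∃ i, N ≤ i ∧ k ≤ i ∧ PrincipalCp D (brNode β i) (t i))

/-- Progressing criterion: every infinite branch carries a progressing `!`-thread. -/
def Progressing (D : Coderivation) : Prop := ∀ β, InfBranch D β → ProgThread D β

/-! ## Basic constructors on coderivations -/

def node0 (r : RuleName) (Γ : Sequent) : Coderivation where
  label w := match w with
    | [] => some (r, Γ)
    | _ :: _ => none
  root_isSome := rfl
  prefix_closed := by
    intro v b h
    match v with
    | [] => exact rfl
    | c :: v' => exact Bool.noConfusion h
  ordered := by
    intro v h
    match v with
    | [] => exact Bool.noConfusion h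
    | c :: v' => exact Bool.noConfusion h

def node1 (r : RuleName) (Γ : Sequent) (D : Coderivation) : Coderivation where
  label w := match w with
    | [] => some (r, Γ)
    | false :: w' => D.label w'
    | true :: _ => none
  root_isSome := rfl
  prefix_closed := by
    intro v b h
    match v with
    | [] => exact rfl
    | false :: v' => exact D.prefix_closed v' b h
    | true :: v' => exact Bool.noConfusion h
  ordered := by
    intro v h
    match v with
    | [] => exact Bool.noConfusion h
    | false :: v' => exact D.ordered v' h
    | true :: v' => exact Bool.noConfusion h

def node2 (r : RuleName) (Γ : Sequent) (D E : Coderivation) : Coderivation where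
  label w := match w with
    | [] => some (r, Γ)
    | false :: w' => D.label w'
    | true :: w' => E.label w'
  root_isSome := rfl
  prefix_closed := by
    intro v b h
    match v with
    | [] => exact rfl
    | false :: v' => exact D.prefix_closed v' b h
    | true :: v' => exact E.prefix_closed v' b h
  ordered := by
    intro v h
    match v with
    | [] => exact D.root_isSome
    | false :: v' => exact D.ordered v' h
    | true :: v' => exact E.ordered v' h

/-- The single-node `hyp` open derivation with conclusion `Γ`. -/
def hypC (Γ : Sequent) : Coderivation := node0 .hyp Γ

/-- The sub-coderivation of `D` rooted at `v` (a default if `v` is not a node of `D`). -/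
def Coderivation.subAt (D : Coderivation) (v : Node) : Coderivation :=
  if h : (D.label v).isSome then
    { label := fun w => D.label (v ++ w)
      root_isSome := by simpa using h
      prefix_closed := by
        intro u b hu
        have hu' : (D.label ((v ++ u) ++ [b])).isSome := by
          rw [List.append_assoc]; exact hu
        exact D.prefix_closed (v ++ u) b hu'
      ordered := by
        intro u hu
        have hu' : (D.label ((v ++ u) ++ [true])).isSome := by
          rw [List.append_assoc]; exact hu
        have h2 := D.ordered (v ++ u) hu'
        show (D.label (v ++ (u ++ [false]))).isSome
        rw [← List.append_assoc]
        exact h2 }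
  else node0 .hyp []

/-! ## Non-wellfounded boxes -/

/-- Splits a node into its number of leading `true`s and, if any, the rest of
the address after the first `false`. -/
def leadSplit : Node → ℕ × Option Node
  | [] => (0, none)
  | true :: w => ((leadSplit w).1 + 1, (leadSplit w).2)
  | false :: w => (0, some w)

lemma leadSplit_append_none (w : Node) (h : (leadSplit w).2 = none) :
    leadSplit (w ++ [true]) = ((leadSplit w).1 + 1, none) ∧
    leadSplit (w ++ [false]) = ((leadSplit w).1, some []) := by
  induction w with
  | nil => exact ⟨rfl, rfl⟩
  | cons c w ih =>
    cases c with
    | false => exact absurd h (by simp [leadSplit])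
    | true =>
      have h' : (leadSplit w).2 = none := by simpa [leadSplit] using h
      obtain ⟨h1, h2⟩ := ih h'
      constructor
      · show leadSplit (true :: (w ++ [true])) = _
        simp [leadSplit, h1]
      · show leadSplit (true :: (w ++ [false])) = _
        simp [leadSplit, h2]

lemma leadSplit_append_some (w u : Node) (h : (leadSplit w).2 = some u) (b : Bool) :
    leadSplit (w ++ [b]) = ((leadSplit w).1, some (u ++ [b])) := by
  induction w with
  | nil => simp [leadSplit] at h
  | cons c w ih =>
    cases c with
    | false =>
      have hw : w = u := by simpa [leadSplit] using h
      subst hw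
      simp [leadSplit]
    | true =>
      have h' : (leadSplit w).2 = some u := by simpa [leadSplit] using h
      have := ih h'
      show leadSplit (true :: (w ++ [b])) = _
      simp [leadSplit, this]

/-- The non-wellfounded box with conclusion `Γ`, whose `i`-th call is `g i`:
its main branch `{ε, 2, 22, …}` consists of `c!p` rules. -/
def nwbOf (Γ : Sequent) (g : ℕ → Coderivation) : Coderivation where
  label w := match (leadSplit w).2 with
    | none => some (.cp, Γ)
    | some u => (g (leadSplit w).1).label u
  root_isSome := rfl
  prefix_closed := by
    intro w b h
    have h' : (match (leadSplit (w ++ [b])).2 with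
      | none => some (RuleName.cp, Γ)
      | some u => (g (leadSplit (w ++ [b])).1).label u).isSome := h
    show (match (leadSplit w).2 with
      | none => some (RuleName.cp, Γ)
      | some u => (g (leadSplit w).1).label u).isSome
    rcases hw : (leadSplit w).2 with _ | u
    · rfl
    · have ha := leadSplit_append_some w u hw b
      rw [ha] at h'
      exact (g (leadSplit w).1).prefix_closed u b h'
  ordered := by
    intro w h
    have h' : (match (leadSplit (w ++ [true])).2 with
      | none => some (RuleName.cp, Γ)
      | some u => (g (leadSplit (w ++ [true])).1).label u).isSome := h
    show (match (leadSplit (w ++ [false])).2 with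
      | none => some (RuleName.cp, Γ)
      | some u => (g (leadSplit (w ++ [false])).1).label u).isSome
    rcases hw : (leadSplit w).2 with _ | u
    · have haf := (leadSplit_append_none w hw).2
      rw [haf]
      exact (g (leadSplit w).1).root_isSome
    · have hat := leadSplit_append_some w u hw true
      have haf := leadSplit_append_some w u hw false
      rw [hat] at h'
      rw [haf]
      exact (g (leadSplit w).1).ordered u h'

/-- The node `v` of `D` is the root of a non-wellfounded box. -/
def IsNwbAt (D : Coderivation) (v : Node) : Prop :=
  ∀ n : ℕ, D.ruleAt (v ++ List.replicate n true) = some .cp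

/-- Every `c!p` rule of `D` belongs to the main branch of a non-wellfounded box. -/
def CpInNwb (D : Coderivation) : Prop :=
  ∀ v, D.ruleAt v = some .cp →
    ∃ w k, v = w ++ List.replicate k true ∧ IsNwbAt D w

/-! ## Regularity and finite expandability -/

def Regular (D : Coderivation) : Prop :=
  {E : Coderivation | ∃ v, D.mem v ∧ E = D.subAt v}.Finite

def WeaklyRegular (D : Coderivation) : Prop :=
  {E : Coderivation | ∃ v, D.ruleAt v = some .cp ∧ E = D.subAt (v ++ [false])}.Finite

def FinExp (D : Coderivation) : Prop :=
  ∀ β, InfBranch D β →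
    {n : ℕ | D.ruleAt (brNode β n) = some .cut ∨ D.ruleAt (brNode β n) = some .qb}.Finite

/-- `rPLL∞`: regular, finitely expandable, progressing coderivations of `PLL∞`. -/
def rPLL (D : Coderivation) : Prop := PLLinf D ∧ Progressing D ∧ FinExp D ∧ Regular D

/-- `wrPLL∞`: weakly regular, finitely expandable, progressing coderivations of `PLL∞`. -/
def wrPLL (D : Coderivation) : Prop := PLLinf D ∧ Progressing D ∧ FinExp D ∧ WeaklyRegular D

def CutFree (D : Coderivation) : Prop := ∀ v, D.ruleAt v ≠ some .cut

/-- No cut-elimination step applies: one premise of each cut is a `hyp`. -/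
def Normal (D : Coderivation) : Prop :=
  ∀ v, D.ruleAt v = some .cut →
    D.ruleAt (v ++ [false]) = some .hyp ∨ D.ruleAt (v ++ [true]) = some .hyp

/-! ## Pruning and approximations -/

lemma prefix_snoc_cases {u v : Node} {x : Bool} (h : u <+: v ++ [x]) :
    u <+: v ∨ u = v ++ [x] := by
  rcases Nat.lt_or_ge u.length (v ++ [x]).length with hl | hl
  · left
    have hle : u.length ≤ v.length := by
      have := hl
      simp only [List.length_append, List.length_cons, List.length_nil] at this
      omega
    exact List.prefix_of_prefix_length_le h (List.prefix_append v [x]) hle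
  · right
    exact h.eq_of_length (le_antisymm h.length_le (le_trans hl (le_of_eq rfl)))

open Classical in
noncomputable def pruneLabel (D : Coderivation) (V : Set Node) (w : Node) :
    Option (RuleName × Sequent) :=
  if ∃ v ∈ V, v <+: w ∧ v ≠ w then none
  else if w ∈ V then (D.label w).map fun p => (.hyp, p.2)
  else D.label w

lemma pruneLabel_isSome {D : Coderivation} {V : Set Node} {w : Node}
    (h : (pruneLabel D V w).isSome) :
    (D.label w).isSome ∧ ¬ ∃ v ∈ V, v <+: w ∧ v ≠ w := by
  classical
  unfold pruneLabel at h
  split_ifs at h with h1 h2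
  · exact absurd h (by simp)
  · exact ⟨by simpa using h, h1⟩
  · exact ⟨h, h1⟩

-- Pruning: replace the sub-coderivations of `D` rooted at the nodes of `V` by `hyp`.
open Classical in
noncomputable def prune (D : Coderivation) (V : Set Node) : Coderivation where
  label := pruneLabel D V
  root_isSome := by
    classical
    unfold pruneLabel
    split_ifs with h1 h2
    · exfalso
      obtain ⟨v, _, hpre, hne⟩ := h1
      exact hne (List.prefix_nil.mp hpre)
    · simpa using D.root_isSome
    · exact D.root_isSome
  prefix_closed := by
    classical
    intro v b h
    obtain ⟨hD, hno⟩ := pruneLabel_isSome h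
    have hDv : (D.label v).isSome := D.prefix_closed v b hD
    have hnov : ¬ ∃ u ∈ V, u <+: v ∧ u ≠ v := by
      rintro ⟨u, hu, hpre, hne⟩
      refine hno ⟨u, hu, hpre.trans (List.prefix_append _ _), fun he => ?_⟩
      have hlen := congrArg List.length he
      have hle : u.length ≤ v.length := hpre.length_le
      simp only [List.length_append, List.length_cons, List.length_nil] at hlen
      omega
    have hvnotV : v ∉ V := by
      intro hv
      refine hno ⟨v, hv, List.prefix_append _ _, fun he => ?_⟩
      have hlen := congrArg List.length he
      simp only [List.length_append, List.length_cons, List.length_nil] at hlen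
      omega
    show (pruneLabel D V v).isSome
    unfold pruneLabel
    rw [if_neg hnov, if_neg hvnotV]
    exact hDv
  ordered := by
    classical
    intro v h
    obtain ⟨hDt, hno⟩ := pruneLabel_isSome h
    have hDf : (D.label (v ++ [false])).isSome := D.ordered v hDt
    have hno' : ¬ ∃ u ∈ V, u <+: v ++ [false] ∧ u ≠ v ++ [false] := by
      rintro ⟨u, hu, hpre, hne⟩
      rcases prefix_snoc_cases hpre with hu_v | heq
      · rcases eq_or_ne u v with rfl | hne'
        · refine hno ⟨u, hu, List.prefix_append _ _, fun he => ?_⟩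
          have hlen := congrArg List.length he
          simp only [List.length_append, List.length_cons, List.length_nil] at hlen
          omega
        · refine hno ⟨u, hu, hu_v.trans (List.prefix_append _ _), fun he => ?_⟩
          have hlen := congrArg List.length he
          have hle : u.length ≤ v.length := hu_v.length_le
          simp only [List.length_append, List.length_cons, List.length_nil] at hlen
          omega
      · exact hne heq
    show (pruneLabel D V (v ++ [false])).isSome
    unfold pruneLabel
    rw [if_neg hno']
    by_cases hmem : v ++ [false] ∈ V
    · rw [if_pos hmem]
      simpa using hDf
    · rw [if_neg hmem]
      exact hDf

/-- `E` approximates `D`: `E` is obtained from `D` by pruning at a set of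
pairwise incomparable nodes. -/
def Approx (E D : Coderivation) : Prop :=
  ∃ V : Set Node, (∀ v ∈ V, ∀ w ∈ V, v <+: w → v = w) ∧ E = prune D V

/-- The greatest cut-free approximation of `D`: prune at the minimal cut nodes. -/
noncomputable def cf (D : Coderivation) : Coderivation :=
  prune D {v | D.ruleAt v = some .cut ∧
    ∀ w, w <+: v → w ≠ v → D.ruleAt w ≠ some .cut}

/-! ## Suprema of countable families of open coderivations -/

open Classical in
noncomputable def chainSupLabel (s : ℕ → Coderivation) (w : Node) :
    Option (RuleName × Sequent) :=
  if h : ∃ i, ((s i).label w).isSome ∧ (s i).ruleAt w ≠ some .hyp then (s h.choose).label w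
  else if h2 : ∃ i, ((s i).label w).isSome then (s h2.choose).label w
  else none

lemma chainSupLabel_isSome (s : ℕ → Coderivation) (w : Node) :
    (chainSupLabel s w).isSome ↔ ∃ i, ((s i).label w).isSome := by
  classical
  unfold chainSupLabel
  split_ifs with h1 h2
  · exact ⟨fun _ => ⟨h1.choose, h1.choose_spec.1⟩, fun _ => h1.choose_spec.1⟩
  · exact ⟨fun _ => h2, fun _ => h2.choose_spec⟩
  · simp [h2]

/-- The supremum of a countable (increasing) family of open coderivations. -/
noncomputable def chainSup (s : ℕ → Coderivation) : Coderivation where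
  label := chainSupLabel s
  root_isSome := (chainSupLabel_isSome s []).mpr ⟨0, (s 0).root_isSome⟩
  prefix_closed := by
    intro v b h
    obtain ⟨i, hi⟩ := (chainSupLabel_isSome s _).mp h
    exact (chainSupLabel_isSome s v).mpr ⟨i, (s i).prefix_closed v b hi⟩
  ordered := by
    intro v h
    obtain ⟨i, hi⟩ := (chainSupLabel_isSome s _).mp h
    exact (chainSupLabel_isSome s _).mpr ⟨i, (s i).ordered v hi⟩

/-! ## Cut elimination steps -/

/-- Iterated weakenings introducing `?Γ` over `E` (of conclusion `Δ`). -/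
def weakAll : List Formula → Sequent → Coderivation → Coderivation
  | [], _, E => E
  | A :: Γ, Δ, E => node1 .qw (A.quest :: (Γ.map .quest ++ Δ)) (weakAll Γ Δ E)

/-- Iterated absorptions absorbing the formulas of `Γ`; the root has conclusion `C`. -/
def absAll : List Formula → Sequent → Coderivation → Coderivation
  | [], _, E => E
  | A :: Γ, C, E => node1 .qb C (absAll Γ (A :: C) E)

/-- Root cut-elimination steps (principal and commutative). -/
inductive StepRoot : Coderivation → Coderivation → Prop where
  | ax (A : Formula) (Δ : Sequent) (E : Coderivation)
      (hE : E.conclusion = A.neg :: Δ) :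
      StepRoot (node2 .cut (A.neg :: Δ) (node0 .ax [A, A.neg]) E) E
  | tens_parr (A B : Formula) (Γ Δ Θ : Sequent) (D E₁ E₂ : Coderivation)
      (hD : D.conclusion = A :: B :: Γ)
      (hE₁ : E₁.conclusion = A.neg :: Δ) (hE₂ : E₂.conclusion = B.neg :: Θ) :
      StepRoot
        (node2 .cut (Γ ++ (Δ ++ Θ))
          (node1 .parr (A.parr B :: Γ) D)
          (node2 .tens (A.neg.tens B.neg :: (Δ ++ Θ)) E₁ E₂))
        (node2 .cut (Γ ++ (Δ ++ Θ))
          (node2 .cut (B :: (Γ ++ Δ)) D E₁) E₂)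
  | one_bot (Γ : Sequent) (D : Coderivation) (hD : D.conclusion = Γ) :
      StepRoot (node2 .cut Γ (node1 .bot (.bot :: Γ) D) (node0 .one [.one])) D
  | cp_cp (A B : Formula) (Γ Δ : Sequent) (D₁ D₂ E₁ E₂ : Coderivation)
      (hD₁ : D₁.conclusion = A :: Γ)
      (hD₂ : D₂.conclusion = A.bang :: Γ.map .quest)
      (hE₁ : E₁.conclusion = B :: A.neg :: Δ)
      (hE₂ : E₂.conclusion = B.bang :: A.neg.quest :: Δ.map .quest) :
      StepRoot
        (node2 .cut (B.bang :: (Γ ++ Δ).map .quest)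
          (node2 .cp (A.bang :: Γ.map .quest) D₁ D₂)
          (node2 .cp (B.bang :: A.neg.quest :: Δ.map .quest) E₁ E₂))
        (node2 .cp (B.bang :: (Γ ++ Δ).map .quest)
          (node2 .cut (B :: (Γ ++ Δ)) D₁ E₁)
          (node2 .cut (B.bang :: (Γ ++ Δ).map .quest) D₂ E₂))
  | cp_qw (A : Formula) (Γ Δ : Sequent) (D₁ D₂ E : Coderivation)
      (hD₁ : D₁.conclusion = A :: Γ)
      (hD₂ : D₂.conclusion = A.bang :: Γ.map .quest)
      (hE : E.conclusion = Δ) :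
      StepRoot
        (node2 .cut (Γ.map .quest ++ Δ)
          (node2 .cp (A.bang :: Γ.map .quest) D₁ D₂)
          (node1 .qw (A.neg.quest :: Δ) E))
        (weakAll Γ Δ E)
  | cp_qb (A : Formula) (Γ Δ : Sequent) (D₁ D₂ E : Coderivation)
      (hD₁ : D₁.conclusion = A :: Γ)
      (hD₂ : D₂.conclusion = A.bang :: Γ.map .quest)
      (hE : E.conclusion = A.neg :: A.neg.quest :: Δ) :
      StepRoot
        (node2 .cut (Γ.map .quest ++ Δ)
          (node2 .cp (A.bang :: Γ.map .quest) D₁ D₂)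
          (node1 .qb (A.neg.quest :: Δ) E))
        (absAll Γ (Γ.map .quest ++ Δ)
          (node2 .cut (Γ ++ (Γ.map .quest ++ Δ)) D₁
            (node2 .cut (A.neg :: (Γ.map .quest ++ Δ)) D₂ E)))
  | fp_fp (A B : Formula) (Γ Δ : Sequent) (D E : Coderivation)
      (hD : D.conclusion = A :: Γ) (hE : E.conclusion = B :: A.neg :: Δ) :
      StepRoot
        (node2 .cut (B.bang :: (Γ ++ Δ).map .quest)
          (node1 .fp (A.bang :: Γ.map .quest) D)
          (node1 .fp (B.bang :: A.neg.quest :: Δ.map .quest) E))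
        (node1 .fp (B.bang :: (Γ ++ Δ).map .quest)
          (node2 .cut (B :: (Γ ++ Δ)) D E))
  | fp_qw (A : Formula) (Γ Δ : Sequent) (D E : Coderivation)
      (hD : D.conclusion = A :: Γ) (hE : E.conclusion = Δ) :
      StepRoot
        (node2 .cut (Γ.map .quest ++ Δ)
          (node1 .fp (A.bang :: Γ.map .quest) D)
          (node1 .qw (A.neg.quest :: Δ) E))
        (weakAll Γ Δ E)
  | fp_qb (A : Formula) (Γ Δ : Sequent) (D E : Coderivation)
      (hD : D.conclusion = A :: Γ) (hE : E.conclusion = A.neg :: A.neg.quest :: Δ) :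
      StepRoot
        (node2 .cut (Γ.map .quest ++ Δ)
          (node1 .fp (A.bang :: Γ.map .quest) D)
          (node1 .qb (A.neg.quest :: Δ) E))
        (absAll Γ (Γ.map .quest ++ Δ)
          (node2 .cut (Γ ++ (Γ.map .quest ++ Δ)) D
            (node2 .cut (A.neg :: (Γ.map .quest ++ Δ))
              (node1 .fp (A.bang :: Γ.map .quest) D) E)))
  | comm1 (r : RuleName) (A : Formula) (Γ Γ' Δ : Sequent) (D E : Coderivation)
      (hr : r ≠ .cut)
      (h1 : RuleOk r (A :: Γ) [A :: Γ'])
      (h2 : RuleOk r (Γ ++ Δ) [Γ' ++ Δ])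
      (hD : D.conclusion = A :: Γ') (hE : E.conclusion = A.neg :: Δ) :
      StepRoot (node2 .cut (Γ ++ Δ) (node1 r (A :: Γ) D) E)
               (node1 r (Γ ++ Δ) (node2 .cut (Γ' ++ Δ) D E))
  | comm2a (r : RuleName) (A : Formula) (Γ Γ₁ Γ₂ Δ : Sequent) (D₁ D₂ E : Coderivation)
      (hr : r ≠ .cut)
      (h1 : RuleOk r (A :: Γ) [A :: Γ₁, Γ₂])
      (h2 : RuleOk r (Γ ++ Δ) [Γ₁ ++ Δ, Γ₂])
      (hD₁ : D₁.conclusion = A :: Γ₁) (hE : E.conclusion = A.neg :: Δ) :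
      StepRoot (node2 .cut (Γ ++ Δ) (node2 r (A :: Γ) D₁ D₂) E)
               (node2 r (Γ ++ Δ) (node2 .cut (Γ₁ ++ Δ) D₁ E) D₂)
  | comm2b (r : RuleName) (A : Formula) (Γ Γ₁ Γ₂ Δ : Sequent) (D₁ D₂ E : Coderivation)
      (hr : r ≠ .cut)
      (h1 : RuleOk r (A :: Γ) [Γ₁, A :: Γ₂])
      (h2 : RuleOk r (Γ ++ Δ) [Γ₁, Γ₂ ++ Δ])
      (hD₂ : D₂.conclusion = A :: Γ₂) (hE : E.conclusion = A.neg :: Δ) :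
      StepRoot (node2 .cut (Γ ++ Δ) (node2 r (A :: Γ) D₁ D₂) E)
               (node2 r (Γ ++ Δ) D₁ (node2 .cut (Γ₂ ++ Δ) D₂ E))
  | comm1r (r : RuleName) (A : Formula) (Γ Δ Δ' : Sequent) (D E : Coderivation)
      (hr : r ≠ .cut)
      (h1 : RuleOk r (A.neg :: Δ) [A.neg :: Δ'])
      (h2 : RuleOk r (Γ ++ Δ) [Γ ++ Δ'])
      (hD : D.conclusion = A :: Γ) (hE : E.conclusion = A.neg :: Δ') :
      StepRoot (node2 .cut (Γ ++ Δ) D (node1 r (A.neg :: Δ) E))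
               (node1 r (Γ ++ Δ) (node2 .cut (Γ ++ Δ') D E))
  | comm2ra (r : RuleName) (A : Formula) (Γ Δ Δ₁ Δ₂ : Sequent) (D E₁ E₂ : Coderivation)
      (hr : r ≠ .cut)
      (h1 : RuleOk r (A.neg :: Δ) [A.neg :: Δ₁, Δ₂])
      (h2 : RuleOk r (Γ ++ Δ) [Γ ++ Δ₁, Δ₂])
      (hD : D.conclusion = A :: Γ) (hE₁ : E₁.conclusion = A.neg :: Δ₁) :
      StepRoot (node2 .cut (Γ ++ Δ) D (node2 r (A.neg :: Δ) E₁ E₂))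
               (node2 r (Γ ++ Δ) (node2 .cut (Γ ++ Δ₁) D E₁) E₂)
  | comm2rb (r : RuleName) (A : Formula) (Γ Δ Δ₁ Δ₂ : Sequent) (D E₁ E₂ : Coderivation)
      (hr : r ≠ .cut)
      (h1 : RuleOk r (A.neg :: Δ) [Δ₁, A.neg :: Δ₂])
      (h2 : RuleOk r (Γ ++ Δ) [Δ₁, Γ ++ Δ₂])
      (hD : D.conclusion = A :: Γ) (hE₂ : E₂.conclusion = A.neg :: Δ₂) :
      StepRoot (node2 .cut (Γ ++ Δ) D (node2 r (A.neg :: Δ) E₁ E₂))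
               (node2 r (Γ ++ Δ) E₁ (node2 .cut (Γ ++ Δ₂) D E₂))

/-- A cut-elimination step performed at node `v`. -/
inductive StepAt : Node → Coderivation → Coderivation → Prop where
  | here {D E : Coderivation} : StepRoot D E → StepAt [] D E
  | in1 {v : Node} {D D' : Coderivation} (r : RuleName) (Γ : Sequent) :
      StepAt v D D' → StepAt (false :: v) (node1 r Γ D) (node1 r Γ D')
  | in2l {v : Node} {D D' : Coderivation} (r : RuleName) (Γ : Sequent) (E : Coderivation) :
      StepAt v D D' → StepAt (false :: v) (node2 r Γ D E) (node2 r Γ D' E)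
  | in2r {v : Node} {E E' : Coderivation} (r : RuleName) (Γ : Sequent) (D : Coderivation) :
      StepAt v E E' → StepAt (true :: v) (node2 r Γ D E) (node2 r Γ D E')

/-- One step of cut elimination. -/
def Step (D E : Coderivation) : Prop := ∃ v, StepAt v D E

/-! ## Infinitary cut-elimination strategies -/

/-- Upper bound for the approximation order. -/
def IsUB (S : Set Coderivation) (u : Coderivation) : Prop := ∀ x ∈ S, Approx x u

/-- Least upper bound for the approximation order. -/
def IsLubA (S : Set Coderivation) (u : Coderivation) : Prop :=
  IsUB S u ∧ ∀ w, IsUB S w → Approx u w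

/-- Scott continuity with respect to the approximation order. -/
def ScottCont (f : Coderivation → Coderivation) : Prop :=
  (∀ D E, Approx D E → Approx (f D) (f E)) ∧
  ∀ S u, S.Nonempty → DirectedOn Approx S → IsLubA S u → IsLubA (f '' S) (f u)

/-- An infinitary cut-elimination strategy: for each open coderivation `D`, a
reduction sequence `σ_D` of length `len D ≤ ω`, starting at `D`, performing a
cut-elimination step at each stage, and constant after `len D`. -/
structure Ices where
  seq : Coderivation → ℕ → Coderivation
  len : Coderivation → ℕ∞
  seq_zero : ∀ D, seq D 0 = D
  seq_step : ∀ D (i : ℕ), (i : ℕ∞) < len D → Step (seq D i) (seq D (i + 1))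
  seq_stable : ∀ D (i : ℕ), len D ≤ (i : ℕ∞) → seq D (i + 1) = seq D i

/-- The function computed by an ices: the supremum of the greatest cut-free
approximations along the reduction sequence. -/
noncomputable def fIces (σ : Ices) (D : Coderivation) : Coderivation :=
  chainSup fun i => cf (σ.seq D i)

/-- Maximality: on (finite) open derivations the strategy reaches a normal form. -/
def Ices.Maximal (σ : Ices) : Prop :=
  ∀ D, OPLLinf D → D.IsFinite → ∃ n : ℕ, σ.len D = (n : ℕ∞) ∧ Normal (σ.seq D n)

/-- Maximal and continuous infinitary cut-elimination strategy (mc-ices). -/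
def Ices.IsMc (σ : Ices) : Prop := σ.Maximal ∧ ScottCont (fIces σ)

/-! ## The height-by-height strategy -/

/-- Code of a node: smaller codes mean smaller height, and for equal heights,
more to the left. -/
def nodeCode (v : Node) : ℕ := v.foldl (fun n b => 2 * n + cond b 1 0) 1

open Classical in
noncomputable def hbhNext (D : Coderivation) : Coderivation :=
  if h : ∃ n, ∃ v E, StepAt v D E ∧ nodeCode v = n then
    (Nat.find_spec h).choose_spec.choose
  else D

/-- The height-by-height reduction sequence: at each stage, one cut-elimination
step is applied to the leftmost reducible cut of minimal height. -/
noncomputable def hbhSeq (D : Coderivation) : ℕ → Coderivation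
  | 0 => D
  | n + 1 => hbhNext (hbhSeq D n)

/-- `f_{σ∞}`, the function computed by the height-by-height strategy. -/
noncomputable def fHbh (D : Coderivation) : Coderivation :=
  chainSup fun i => cf (hbhSeq D i)

/-! ## The Scott domain of open coderivations -/

/-- Open coderivations with conclusion `Γ`. -/
def Dom (Γ : Sequent) : Set Coderivation := {D | OPLLinf D ∧ D.conclusion = Γ}

def IsLubOn (Γ : Sequent) (S : Set Coderivation) (u : Coderivation) : Prop :=
  u ∈ Dom Γ ∧ IsUB S u ∧ ∀ w ∈ Dom Γ, IsUB S w → Approx u w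

/-- Compactness in the domain of open coderivations with conclusion `Γ`. -/
def CompactOn (Γ : Sequent) (x : Coderivation) : Prop :=
  ∀ S, S ⊆ Dom Γ → S.Nonempty → DirectedOn Approx S →
    ∀ u, IsLubOn Γ S u → Approx x u → ∃ y ∈ S, Approx x y

/-- Maximality in the domain of open coderivations with conclusion `Γ`. -/
def MaxOn (Γ : Sequent) (x : Coderivation) : Prop :=
  ∀ y ∈ Dom Γ, Approx x y → x = y

/-! ## Relational semantics -/

/-- Codes for points of the relational model (`D_X := ℕ` for each variable):
`uStar` interprets units, `uEl` elements of the web of a variable, `uPair`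
pairs, `uMSet` finite multisets. -/
def uStar : ℕ := Nat.pair 0 0
def uEl (n : ℕ) : ℕ := Nat.pair 1 n
def uPair (a b : ℕ) : ℕ := Nat.pair 2 (Nat.pair a b)
noncomputable def uMSet (m : Multiset ℕ) : ℕ := Nat.pair 3 (Encodable.encode m)

/-- The web of a formula. -/
noncomputable def semF : Formula → Set ℕ
  | .var _ => Set.range uEl
  | .covar _ => Set.range uEl
  | .one => {uStar}
  | .bot => {uStar}
  | .tens A B => {x | ∃ a ∈ semF A, ∃ b ∈ semF B, x = uPair a b}
  | .parr A B => {x | ∃ a ∈ semF A, ∃ b ∈ semF B, x = uPair a b}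
  | .bang A => {x | ∃ m : Multiset ℕ, (∀ a ∈ m, a ∈ semF A) ∧ x = uMSet m}
  | .quest A => {x | ∃ m : Multiset ℕ, (∀ a ∈ m, a ∈ semF A) ∧ x = uMSet m}

/-- Pointwise merge of a tuple of elements into a tuple of multisets. -/
inductive MergeM : List ℕ → List ℕ → List ℕ → Prop where
  | nil : MergeM [] [] []
  | cons (x : ℕ) (m : Multiset ℕ) {xs ms ts : List ℕ} :
      MergeM xs ms ts → MergeM (x :: xs) (uMSet m :: ms) (uMSet (x ::ₘ m) :: ts)

/-- Transport of a tuple along a position alignment. -/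
def AlignedTuple (f : ℕ → ℕ) (t t₀ : List ℕ) : Prop :=
  t.length = t₀.length ∧ ∀ i, i < t.length → t₀[f i]? = t[i]?

/-- The semantic clause of each rule, on canonical instances; `S b` is the
(already transported) interpretation of premise `b`. -/
noncomputable def CanonSem : RuleName → Sequent → (Bool → Set (List ℕ)) → Set (List ℕ)
  | .ax, C₀, _ => {t | ∃ A x, C₀ = [A, A.neg] ∧ x ∈ semF A ∧ t = [x, x]}
  | .cut, _, S => {t | ∃ z u v, (z :: u) ∈ S false ∧ (z :: v) ∈ S true ∧ t = u ++ v}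
  | .tens, _, S =>
      {t | ∃ a b u v, (a :: u) ∈ S false ∧ (b :: v) ∈ S true ∧ t = uPair a b :: (u ++ v)}
  | .parr, _, S => {t | ∃ a b u, (a :: b :: u) ∈ S false ∧ t = uPair a b :: u}
  | .one, _, _ => {[uStar]}
  | .bot, _, S => {t | ∃ u ∈ S false, t = uStar :: u}
  | .qw, _, S => {t | ∃ u ∈ S false, t = uMSet 0 :: u}
  | .qb, _, S =>
      {t | ∃ y, ∃ μ : Multiset ℕ, ∃ u, (y :: uMSet μ :: u) ∈ S false ∧ t = uMSet (y ::ₘ μ) :: u}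
  | .cp, C₀, S =>
      {t | t = List.replicate C₀.length (uMSet 0)} ∪
      {t | ∃ x xs m ms ts, (x :: xs) ∈ S false ∧ (uMSet m :: ms) ∈ S true ∧
        MergeM xs ms ts ∧ t = uMSet (x ::ₘ m) :: ts}
  | .dig, _, S =>
      {t | ∃ ms : List (Multiset ℕ), ∃ u,
        (uMSet ((ms.map uMSet : List ℕ) : Multiset ℕ) :: u) ∈ S false ∧
        t = uMSet ms.sum :: u}
  | _, _, _ => ∅

/-- The `n`-th finite stage of the relational interpretation of a coderivation. -/
noncomputable def interpN : ℕ → Coderivation → Set (List ℕ)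
  | 0, _ => ∅
  | n + 1, D =>
    {t | ∃ r C C₀ ps₀ f t₀,
      D.label [] = some (r, C) ∧ Canon r C₀ ps₀ ∧ PosAlign C C₀ f ∧
      AlignedTuple f t t₀ ∧
      t₀ ∈ CanonSem r C₀ (fun b =>
        {u₀ | ∃ P P₀ g u, D.seqAt [b] = some P ∧ ps₀[bIdx b]? = some P₀ ∧
          PosAlign P P₀ g ∧ AlignedTuple g u u₀ ∧ u ∈ interpN n (D.subAt [b])})}

/-- The relational interpretation `⟦D⟧` of a coderivation. -/
noncomputable def interp (D : Coderivation) : Set (List ℕ) := ⋃ n, interpN n D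

/-! ## Finite (wellfounded) derivations of `PLL` and `nuPLL`, and their translations -/

/-- Finite derivation trees (for `PLL`). -/
inductive PDeriv : Type where
  | p0 (r : RuleName) (Γ : Sequent) : PDeriv
  | p1 (r : RuleName) (Γ : Sequent) (D : PDeriv) : PDeriv
  | p2 (r : RuleName) (Γ : Sequent) (D E : PDeriv) : PDeriv

def PDeriv.concl : PDeriv → Sequent
  | .p0 _ Γ => Γ
  | .p1 _ Γ _ => Γ
  | .p2 _ Γ _ _ => Γ

/-- Valid derivations of the sequent calculus `PLL`. -/
inductive PValid : PDeriv → Prop where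
  | p0 (r : RuleName) (Γ : Sequent) :
      r ∈ pllRules → RuleOk r Γ [] → PValid (.p0 r Γ)
  | p1 (r : RuleName) (Γ : Sequent) (D : PDeriv) :
      r ∈ pllRules → RuleOk r Γ [D.concl] → PValid D → PValid (.p1 r Γ D)
  | p2 (r : RuleName) (Γ : Sequent) (D E : PDeriv) :
      r ∈ pllRules → RuleOk r Γ [D.concl, E.concl] → PValid D → PValid E →
      PValid (.p2 r Γ D E)

/-- The translation `(·)° : PLL → PLL∞`, unfolding each functorial promotion
into a non-wellfounded box all of whose calls are equal. -/
def PDeriv.toCo : PDeriv → Coderivation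
  | .p0 r Γ => node0 r Γ
  | .p1 r Γ D => if r = .fp then nwbOf Γ (fun _ => D.toCo) else node1 r Γ D.toCo
  | .p2 r Γ D E => node2 r Γ D.toCo E.toCo

/-- Wellfounded, infinitely-branching derivation trees (for `nuPLL`). -/
inductive NDeriv : Type where
  | n0 (r : RuleName) (Γ : Sequent) : NDeriv
  | n1 (r : RuleName) (Γ : Sequent) (D : NDeriv) : NDeriv
  | n2 (r : RuleName) (Γ : Sequent) (D E : NDeriv) : NDeriv
  | nup (Γ : Sequent) (f : ℕ → NDeriv) : NDeriv

def NDeriv.concl : NDeriv → Sequent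
  | .n0 _ Γ => Γ
  | .n1 _ Γ _ => Γ
  | .n2 _ Γ _ _ => Γ
  | .nup Γ _ => Γ

def nupllRules : Set RuleName := {.ax, .cut, .tens, .parr, .one, .bot, .qw, .qb}

/-- Valid derivations of `nuPLL`: the infinitely branching promotion `ν!p` has
countably many premises with the same conclusion, finitely many of which are
distinct. -/
inductive NValid : NDeriv → Prop where
  | n0 (r : RuleName) (Γ : Sequent) :
      r ∈ nupllRules → RuleOk r Γ [] → NValid (.n0 r Γ)
  | n1 (r : RuleName) (Γ : Sequent) (D : NDeriv) :
      r ∈ nupllRules → RuleOk r Γ [D.concl] → NValid D → NValid (.n1 r Γ D)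
  | n2 (r : RuleName) (Γ : Sequent) (D E : NDeriv) :
      r ∈ nupllRules → RuleOk r Γ [D.concl, E.concl] → NValid D → NValid E →
      NValid (.n2 r Γ D E)
  | nup (Γ : Sequent) (f : ℕ → NDeriv) :
      (∀ i, NValid (f i)) → (Set.range f).Finite →
      (∀ i, (f i).concl = (f 0).concl) →
      RuleOk .fp Γ [(f 0).concl] →
      NValid (.nup Γ f)

/-- The translation `(·)• : nuPLL → PLL∞`, unfolding each `ν!p` with premises
`(D_i)` into the non-wellfounded box whose `i`-th call is `D_i•`. -/
def NDeriv.toCo : NDeriv → Coderivation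
  | .n0 r Γ => node0 r Γ
  | .n1 r Γ D => node1 r Γ D.toCo
  | .n2 r Γ D E => node2 r Γ D.toCo E.toCo
  | .nup Γ f => nwbOf Γ (fun i => (f i).toCo)

/-! ## The digging counterexample -/

def fX : Formula := .var 0

/-- `N := !(X ⊸ X) ⊸ X ⊸ X = ?(X ⊗ X^⊥) ⅋ (X^⊥ ⅋ X)`. -/
def fN : Formula := (Formula.quest (fX.tens fX.neg)).parr (fX.neg.parr fX)

/-- The derivation `0` of `⊢ N` (weakening over an axiom). -/
def cod0 : Coderivation :=
  node1 .parr [fN]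
    (node1 .parr [.quest (fX.tens fX.neg), fX.neg.parr fX]
      (node1 .qw [.quest (fX.tens fX.neg), fX.neg, fX]
        (node0 .ax [fX.neg, fX])))

/-- The derivation `1` of `⊢ N` (absorption over a weakened tensor of axioms). -/
def cod1 : Coderivation :=
  node1 .parr [fN]
    (node1 .parr [.quest (fX.tens fX.neg), fX.neg.parr fX]
      (node1 .qb [.quest (fX.tens fX.neg), fX.neg, fX]
        (node1 .qw [fX.tens fX.neg, .quest (fX.tens fX.neg), fX.neg, fX]
          (node2 .tens [fX.tens fX.neg, fX.neg, fX]
            (node0 .ax [fX, fX.neg])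
            (node0 .ax [fX.neg, fX])))))

/-- The non-wellfounded box `⟨0,1,0,1,…⟩` of conclusion `⊢ !N`. -/
def boxAlt : Coderivation := nwbOf [fN.bang] fun i => if i % 2 = 0 then cod0 else cod1

/-- Digging applied to the axiom `⊢ ??N^⊥, !!N`. -/
def digCo : Coderivation :=
  node1 .dig [fN.neg.quest, fN.bang.bang]
    (node0 .ax [fN.neg.quest.quest, fN.bang.bang])

/-- The coderivation `D_??d` of `⊢ !!N`. -/
def Ddig : Coderivation := node2 .cut [fN.bang.bang] boxAlt digCo

/-! ## Size of sequents -/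

/-- The number of symbols of a formula. -/
def Formula.size : Formula → ℕ
  | .var _ => 1
  | .covar _ => 1
  | .tens A B => A.size + B.size + 1
  | .parr A B => A.size + B.size + 1
  | .bang A => A.size + 1
  | .quest A => A.size + 1
  | .one => 1
  | .bot => 1

lemma Formula.size_pos (A : Formula) : 0 < A.size := by
  cases A <;> simp [Formula.size]

/-- The number of symbols of a sequent. -/
def Sequent.size (Γ : Sequent) : ℕ := (List.map Formula.size Γ).sum

@[simp] lemma Sequent.size_cons (A : Formula) (Γ : Sequent) :
    Sequent.size (A :: Γ) = A.size + Sequent.size Γ := rfl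

@[simp] lemma Sequent.size_append (Γ Δ : Sequent) :
    Sequent.size (Γ ++ Δ) = Sequent.size Γ + Sequent.size Δ := by
  simp [Sequent.size]

lemma Sequent.size_perm {Γ Δ : Sequent} (h : Γ.Perm Δ) : Sequent.size Γ = Sequent.size Δ :=
  (h.map _).sum_eq

lemma Sequent.size_le_size_map_quest (Γ : Sequent) :
    Sequent.size Γ ≤ Sequent.size (Γ.map .quest) := by
  induction Γ with
  | nil => exact le_rfl
  | cons A Γ ih => simp only [List.map_cons, Sequent.size_cons, Formula.size]; omega

/-- Apart from cut, absorption and digging, every premise is smaller than the conclusion,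
except the right premise of `c!p`, which has the same size. -/
lemma Canon.size_premise {r : RuleName} {C : Sequent} {ps : List Sequent} (h : Canon r C ps)
    (hr : r ∈ pllInfRules) (hcut : r ≠ .cut) (hqb : r ≠ .qb) {i : ℕ} {P : Sequent}
    (hP : ps[i]? = some P) :
    P.size < C.size ∨ P.size = C.size ∧ r = .cp ∧ i = 1 := by
  cases h with
  | ax | one => simp at hP
  | cut => exact absurd rfl hcut
  | qb => exact absurd rfl hqb
  | hyp | dig | fp => simp [pllInfRules] at hr
  | tens A B Γ Δ =>
    rcases i with _ | _ | i <;> simp at hP <;> subst hP <;> simp [Formula.size] <;> omega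
  | parr A B Γ =>
    rcases i with _ | i <;> simp at hP
    subst hP; simp [Formula.size]; omega
  | bot Γ =>
    rcases i with _ | i <;> simp at hP
    subst hP; simp [Formula.size]
  | qw A Γ =>
    rcases i with _ | i <;> simp at hP
    subst hP; simp [Formula.size]
  | cp A Γ =>
    rcases i with _ | _ | i <;> simp at hP <;> subst hP
    · have := Sequent.size_le_size_map_quest Γ
      simp [Formula.size]; omega
    · simp

lemma RuleOk.size_premise {r : RuleName} {C : Sequent} {ps : List Sequent} (h : RuleOk r C ps)
    (hr : r ∈ pllInfRules) (hcut : r ≠ .cut) (hqb : r ≠ .qb) {i : ℕ} {P : Sequent}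
    (hP : ps[i]? = some P) :
    P.size < C.size ∨ P.size = C.size ∧ r = .cp ∧ i = 1 := by
  obtain ⟨C₀, ps₀, hc, hC, hps⟩ := h
  obtain ⟨hi, rfl⟩ := List.getElem?_eq_some_iff.mp hP
  have hi₀ : i < ps₀.length := hps.length_eq ▸ hi
  have hperm : ps[i].Perm ps₀[i] := hps.get hi hi₀
  rw [Sequent.size_perm hC, Sequent.size_perm hperm]
  exact hc.size_premise hr hcut hqb (by simp [hi₀])

namespace Coderivation

lemma premsAt_bIdx (D : Coderivation) {v : Node} {b : Bool} {P : Sequent}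
    (h : D.seqAt (v ++ [b]) = some P) : (D.premsAt v)[bIdx b]? = some P := by
  cases b with
  | false => simp [premsAt, h, bIdx]
  | true =>
    have hf : (D.label (v ++ [false])).isSome := by
      apply D.ordered
      rw [seqAt, Option.map_eq_some_iff] at h
      obtain ⟨p, hp, -⟩ := h
      simp [hp]
    obtain ⟨q, hq⟩ := Option.isSome_iff_exists.mp hf
    have hq' : D.seqAt (v ++ [false]) = some q.2 := by simp [seqAt, hq]
    simp [premsAt, h, hq', bIdx]

lemma mem_of_prefix (D : Coderivation) {u v : Node} (h : u <+: v) (hv : D.mem v) : D.mem u := by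
  obtain ⟨w, rfl⟩ := h
  induction w using List.reverseRecOn with
  | nil => simpa using hv
  | append_singleton w b ih =>
    rw [← List.append_assoc] at hv
    exact ih (D.prefix_closed _ b hv)

end Coderivation

/-! ## Branches -/

lemma brNode_succ (β : ℕ → Bool) (n : ℕ) : brNode β (n + 1) = brNode β n ++ [β n] := by
  simp [brNode, List.range_succ]

lemma brNode_add_of_true {β : ℕ → Bool} {N : ℕ} (h : ∀ n, N ≤ n → β n = true) (k : ℕ) :
    brNode β (N + k) = brNode β N ++ List.replicate k true := by
  induction k with
  | zero => simp
  | succ k ih =>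
    rw [← add_assoc, brNode_succ, ih, h _ (Nat.le_add_right N k), List.append_assoc,
      ← List.replicate_succ']

/-- König's lemma for coderivations. -/
lemma exists_infBranch_of_not_isFinite {D : Coderivation} (h : ¬ D.IsFinite) :
    ∃ β, InfBranch D β := by
  let P : Node → Prop := fun v => {w | D.mem w ∧ v <+: w}.Infinite
  have step : ∀ v, P v → ∃ b, P (v ++ [b]) := by
    intro v hv
    by_contra! hb
    refine hv ((((Set.not_infinite.mp (hb false)).union
      (Set.not_infinite.mp (hb true))).insert v).subset ?_)
    rintro _ ⟨hw, u, rfl⟩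
    rcases u with _ | ⟨_ | _, u⟩
    · simp
    · exact Or.inr (Or.inl ⟨hw, u, by simp⟩)
    · exact Or.inr (Or.inr ⟨hw, u, by simp⟩)
  choose! b hb using step
  let u : ℕ → Node := fun n => Nat.rec [] (fun _ v => v ++ [b v]) n
  have hu : ∀ n, P (u n) := by
    intro n
    induction n with
    | zero => exact fun hfin => h (hfin.subset fun w hw => ⟨hw, List.nil_prefix⟩)
    | succ n ih => exact hb _ ih
  have hbr : ∀ n, brNode (fun n => b (u n)) n = u n := by
    intro n
    induction n with
    | zero => rfl
    | succ n ih => rw [brNode_succ, ih]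
  refine ⟨fun n => b (u n), fun n => ?_⟩
  obtain ⟨w, hw, hpre⟩ := (hu n).nonempty
  rw [hbr]
  exact D.mem_of_prefix hpre hw

/-- In a finitely expandable coderivation, every infinite branch eventually follows the main
branch of a non-wellfounded box. -/
lemma exists_isNwbAt_brNode {D : Coderivation} (hD : PLLinf D) (hfe : FinExp D) {β : ℕ → Bool}
    (hβ : InfBranch D β) : ∃ n, IsNwbAt D (brNode β n) := by
  choose p hp using fun n => Option.isSome_iff_exists.mp (hβ n)
  obtain ⟨N, hN⟩ := (hfe β hβ).bddAbove
  have hstep : ∀ n, N < n → (p (n + 1)).2.size < (p n).2.size ∨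
      (p (n + 1)).2.size = (p n).2.size ∧ (p n).1 = .cp ∧ β n = true := by
    intro n hn
    obtain ⟨hr, hok⟩ := hD _ (p n).1 (p n).2 (hp n)
    have hrule : D.ruleAt (brNode β n) = some (p n).1 := by simp [Coderivation.ruleAt, hp n]
    have hne : ¬ ((p n).1 = .cut ∨ (p n).1 = .qb) := by
      intro h
      refine absurd (hN (a := n) ?_) (not_le.mpr hn)
      simpa [hrule] using h
    push Not at hne
    have hseq : D.seqAt (brNode β n ++ [β n]) = some (p (n + 1)).2 := by
      rw [← brNode_succ]; simp [Coderivation.seqAt, hp (n + 1)]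
    rcases hok.size_premise hr hne.1 hne.2 (D.premsAt_bIdx hseq) with h | ⟨h, hcp, hb⟩
    · exact Or.inl h
    · refine Or.inr ⟨h, hcp, ?_⟩
      cases hβn : β n with
      | true => rfl
      | false => simp [hβn, bIdx] at hb
  have hanti : Antitone fun k => (p (N + 1 + k)).2.size :=
    antitone_nat_of_succ_le fun k => by
      rcases hstep (N + 1 + k) (by omega) with h | h
      · exact h.le
      · exact h.1.le
  obtain ⟨M, hM⟩ : ∃ M, ∀ k, (p (N + 1 + M)).2.size ≤ (p (N + 1 + k)).2.size :=
    ⟨_, fun k => Function.argmin_le (fun k => (p (N + 1 + k)).2.size) k⟩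
  have hcp : ∀ n, N + 1 + M ≤ n → (p n).1 = .cp ∧ β n = true := by
    intro n hn
    obtain ⟨k, rfl⟩ := Nat.exists_eq_add_of_le hn
    rcases hstep (N + 1 + M + k) (by omega) with h | h
    · have h1 := hanti (Nat.le_add_right M k)
      have h2 := hM (M + k + 1)
      simp only [← add_assoc] at h1 h2 h
      omega
    · exact h.2
  refine ⟨N + 1 + M, fun k => ?_⟩
  rw [← brNode_add_of_true (fun n hn => (hcp n hn).2), Coderivation.ruleAt, hp,
    Option.map_some, (hcp _ (Nat.le_add_right _ k)).1]

/-! ## Pruning at minimal box roots -/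

lemma IsNwbAt.mem {D : Coderivation} {v : Node} (h : IsNwbAt D v) : D.mem v := by
  have h0 := h 0
  rw [List.replicate_zero, List.append_nil, Coderivation.ruleAt, Option.map_eq_some_iff] at h0
  obtain ⟨p, hp, -⟩ := h0
  simp [Coderivation.mem, hp]

/-- The roots of non-wellfounded boxes that are not proper descendants of another such root. -/
def minNwb (D : Coderivation) : Set Node :=
  {v | IsNwbAt D v ∧ ∀ u, IsNwbAt D u → u <+: v → u = v}

lemma exists_minNwb_prefix {D : Coderivation} {v : Node} (h : IsNwbAt D v) :
    ∃ u ∈ minNwb D, u <+: v := by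
  induction hn : v.length using Nat.strong_induction_on generalizing v with
  | _ n ih =>
    by_cases hmin : ∀ u, IsNwbAt D u → u <+: v → u = v
    · exact ⟨v, ⟨h, hmin⟩, List.prefix_rfl⟩
    · push Not at hmin
      obtain ⟨u, hu, hpre, hne⟩ := hmin
      have hlt : u.length < n := by
        rw [← hn]
        exact lt_of_le_of_ne hpre.length_le fun he => hne (hpre.eq_of_length he)
      obtain ⟨w, hw, hwu⟩ := ih _ hlt hu rfl
      exact ⟨w, hw, hwu.trans hpre⟩

lemma prune_isFinite_minNwb {D : Coderivation} (hD : PLLinf D) (hfe : FinExp D) :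
    (prune D (minNwb D)).IsFinite := by
  by_contra hinf
  obtain ⟨β, hβ⟩ := exists_infBranch_of_not_isFinite hinf
  obtain ⟨n, hn⟩ := exists_isNwbAt_brNode hD hfe fun n => (pruneLabel_isSome (hβ n)).1
  obtain ⟨u, hu, hpre⟩ := exists_minNwb_prefix hn
  refine (pruneLabel_isSome (hβ (n + 1))).2 ⟨u, hu, ?_, ?_⟩
  · rw [brNode_succ]
    exact hpre.trans (List.prefix_append _ _)
  · rintro rfl
    have := hpre.length_le
    simp [brNode] at this

lemma prune_mem_of_mem {D : Coderivation} {V : Set Node}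
    (hV : ∀ v ∈ V, ∀ w ∈ V, v <+: w → v = w) {v : Node} (hv : v ∈ V) (hm : D.mem v) :
    (prune D V).mem v := by
  have hno : ¬ ∃ u ∈ V, u <+: v ∧ u ≠ v := fun ⟨u, hu, hpre, hne⟩ => hne (hV u hu v hv hpre)
  change (pruneLabel D V v).isSome
  rw [pruneLabel, if_neg hno, if_pos hv]
  simpa [Coderivation.mem] using hm

lemma prune_seqAt {D : Coderivation} {V : Set Node} {w : Node}
    (h : ¬ ∃ v ∈ V, v <+: w ∧ v ≠ w) : (prune D V).seqAt w = D.seqAt w := by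
  change (pruneLabel D V w).map Prod.snd = (D.label w).map Prod.snd
  rw [pruneLabel, if_neg h]
  split_ifs
  · cases D.label w <;> rfl
  · rfl

lemma oPLLinf_prune {D : Coderivation} (hD : PLLinf D) (V : Set Node) :
    OPLLinf (prune D V) := by
  intro v r Γ hl
  change pruneLabel D V v = some (r, Γ) at hl
  have hno := (pruneLabel_isSome (D := D) (V := V) (w := v) (by simp [hl])).2
  rw [pruneLabel, if_neg hno] at hl
  have hchild : ∀ b, v ++ [b] ≠ v := by simp
  split_ifs at hl with hv
  · obtain ⟨p, -, hp⟩ := Option.map_eq_some_iff.mp hl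
    obtain ⟨rfl, rfl⟩ := Prod.mk.inj hp
    have hnone : ∀ b, (prune D V).seqAt (v ++ [b]) = none := by
      intro b
      change (pruneLabel D V (v ++ [b])).map Prod.snd = none
      rw [pruneLabel, if_pos ⟨v, hv, List.prefix_append _ _, (hchild b).symm⟩]
      rfl
    refine ⟨Set.mem_insert _ _, p.2, [], .hyp _, .refl _, ?_⟩
    simp [Coderivation.premsAt, hnone]
  · obtain ⟨hr, hok⟩ := hD v r Γ hl
    refine ⟨Set.mem_insert_of_mem _ hr, ?_⟩
    have hseq : ∀ b, (prune D V).seqAt (v ++ [b]) = D.seqAt (v ++ [b]) := by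
      intro b
      refine prune_seqAt ?_
      rintro ⟨u, hu, hpre, hne⟩
      rcases prefix_snoc_cases hpre with huv | rfl
      · exact hno ⟨u, hu, huv, fun he => hv (he ▸ hu)⟩
      · exact hne rfl
    simpa [Coderivation.premsAt, hseq] using hok

/-- **Proposition 5.6 (canonical approximation)**: every finitely expandable
progressing coderivation can be pruned, at a finite set of pairwise
incomparable nodes which are all roots of non-wellfounded boxes, to a finite
open derivation. -/
theorem canonical_finite_approximation (D : Coderivation)
    (hD : PLLinf D) (hp : Progressing D) (hfe : FinExp D) :
    ∃ V : Set Node, V.Finite ∧ (∀ v ∈ V, ∀ w ∈ V, v <+: w → v = w) ∧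
      (prune D V).IsFinite ∧ OPLLinf (prune D V) ∧ ∀ v ∈ V, IsNwbAt D v := by
  have hV : ∀ v ∈ minNwb D, ∀ w ∈ minNwb D, v <+: w → v = w :=
    fun v hv w hw hpre => hw.2 v hv.1 hpre
  have hfin := prune_isFinite_minNwb hD hfe
  exact ⟨minNwb D, hfin.subset fun v hv => prune_mem_of_mem hV hv hv.1.mem, hV, hfin,
    oPLLinf_prune hD _, fun v hv => hv.1⟩

end NWPLL
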